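/- Fix a nonzero complex number H and a real number S_v > 0, set σ_eff^2 = S_v/|H|^2, and define the Self-Wiener map by X̂_SW(z) = (√S_v/H)·z·(1 + √(1 - 4|z|^{-2}))/2 for complex z with |z| > 2 and X̂_SW(z) = 0 for |z| ≤ 2. Let V be a standard complex Gaussian random variable (V = V_r + i·V_i with V_r, V_i independent real Gaussians of mean 0 and variance 1/2). For X ∈ ℂ, let η = H·X/√S_v, p(η) = P(|η + V| > 2), and MSE(X) = E[|X - X̂_SW(η + V)|^2]. Then there exist constants C > 0 and η₀ > 0 (depending only on H and S_v) such that for all X with |η| ≥ η₀, | MSE(X) - ( (1 - p(η))·|X|^2 + p(η)·σ_eff^2 ) | ≤ C/|η|^2; note that |X|^2/|η|^2 = σ_eff^2, so the error term is of order σ_eff^2/SNR_out. -/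

import Mathlib

open MeasureTheory ProbabilityTheory Complex

/-- The Self-Wiener estimate as a function of the normalized observation `z`:
it thresholds at `|z| = 2` and otherwise shrinks the least-squares estimate
`(√S_v/H)·z` by the factor `(1 + √(1 - 4|z|⁻²))/2`. -/
noncomputable def swMap (H : ℂ) (Sv : ℝ) (z : ℂ) : ℂ :=
  if 2 < ‖z‖ then
    ((Real.sqrt Sv : ℂ) / H) * z
      * (((1 + Real.sqrt (1 - 4 * (‖z‖ ^ 2)⁻¹)) / 2 : ℝ) : ℂ)
  else 0

/-- Above the threshold, with `s = √(1 - 4|z|⁻²)` and `z = η + v`, the squared error of the shrunk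
observation agrees with `|v|² - 2 Re (v/η)` up to `O((1 + |v|⁴)/|η|²)`. -/
lemma abs_normSq_sub_shrink_le {η v : ℂ} {s : ℝ} (hη : 4 ≤ ‖η‖) (hz : 2 < ‖η + v‖)
    (hs0 : 0 ≤ s) (hs : s ^ 2 = 1 - 4 * (‖η + v‖ ^ 2)⁻¹) :
    |‖η - (η + v) * (((1 + s) / 2 : ℝ) : ℂ)‖ ^ 2 - (‖v‖ ^ 2 - 2 * (v / η).re)|
      ≤ 100 * (1 + ‖v‖ ^ 4) / ‖η‖ ^ 2 := by
  set z := η + v with hzdef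
  have hη0 : η ≠ 0 := norm_pos_iff.mp (by linarith)
  have hz0 : z ≠ 0 := norm_pos_iff.mp (by linarith)
  have hcη : (starRingEnd ℂ) η ≠ 0 := by simpa using hη0
  have hcz : (starRingEnd ℂ) z ≠ 0 := by simpa using hz0
  have hr : 0 < ‖z‖ := by linarith
  have hs1 : s ≤ 1 := by
    have : 0 < 4 * (‖z‖ ^ 2)⁻¹ := by positivity
    nlinarith
  have hr2 : ‖z‖ ^ 2 * (1 - s ^ 2) = 4 := by rw [hs]; field_simp; ring
  set h : ℂ := z * (((1 - s) / 2 : ℝ) : ℂ) with hh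
  have hnorm : ‖h‖ = ‖z‖ * ((1 - s) / 2) := by
    rw [hh, norm_mul, Complex.norm_of_nonneg (by linarith)]
  have hzh : ‖z‖ * ‖h‖ ≤ 2 := by
    rw [hnorm]
    nlinarith [mul_nonneg (sq_nonneg ‖z‖) (mul_nonneg hs0 (sub_nonneg.2 hs1))]
  have hh1 : ‖h‖ ≤ 1 := by nlinarith [norm_nonneg h]
  have hηz : ‖η‖ ≤ ‖z‖ + ‖v‖ := by
    have := norm_sub_le z v
    rwa [hzdef, add_sub_cancel_right] at this
  have hηh : ‖η‖ * ‖h‖ ≤ 2 + ‖v‖ := by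
    nlinarith [norm_nonneg h, norm_nonneg v]
  have hηh2 : ‖η‖ ^ 2 * ‖h‖ ^ 2 ≤ (2 + ‖v‖) ^ 2 := by
    rw [← mul_pow]; gcongr
  have herr : η - z * (((1 + s) / 2 : ℝ) : ℂ) = h - v := by
    rw [hh, hzdef]; push_cast; ring
  have hsplit : h - 1 / (starRingEnd ℂ) η
      = z * ((((1 - s) / 2) ^ 2 : ℝ) : ℂ)
        - (starRingEnd ℂ) v / ((starRingEnd ℂ) z * (starRingEnd ℂ) η) := by
    have e1 : h - 1 / (starRingEnd ℂ) z = z * ((((1 - s) / 2) ^ 2 : ℝ) : ℂ) := by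
      have hzz : z * (starRingEnd ℂ) z * (1 - (s : ℂ) ^ 2) = 4 := by
        rw [Complex.mul_conj, Complex.normSq_eq_norm_sq]
        exact_mod_cast hr2
      rw [hh]
      field_simp
      push_cast
      linear_combination (1 / 4 : ℂ) * hzz
    have e2 : 1 / (starRingEnd ℂ) z - 1 / (starRingEnd ℂ) η
        = - ((starRingEnd ℂ) v / ((starRingEnd ℂ) z * (starRingEnd ℂ) η)) := by
      field_simp
      rw [hzdef, map_add]; ring
    linear_combination e1 + e2
  have hdiff : ‖η‖ ^ 2 * ‖h - 1 / (starRingEnd ℂ) η‖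
      ≤ (2 + ‖v‖) ^ 2 / 2 + ‖v‖ * (1 + ‖v‖ / 2) := by
    have t1 : ‖z * ((((1 - s) / 2) ^ 2 : ℝ) : ℂ)‖ ≤ ‖h‖ ^ 2 / 2 := by
      rw [norm_mul, Complex.norm_of_nonneg (by positivity), hnorm]
      nlinarith [mul_nonneg hr.le (sq_nonneg ((1 - s) / 2))]
    have t2 : ‖η‖ ^ 2 * ‖(starRingEnd ℂ) v / ((starRingEnd ℂ) z * (starRingEnd ℂ) η)‖
        ≤ ‖v‖ * (1 + ‖v‖ / 2) := by
      rw [norm_div, norm_mul, RCLike.norm_conj, RCLike.norm_conj, RCLike.norm_conj]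
      have : ‖η‖ ^ 2 * (‖v‖ / (‖z‖ * ‖η‖)) = ‖v‖ * (‖η‖ / ‖z‖) := by
        have : ‖η‖ ≠ 0 := by positivity
        field_simp
      rw [this]
      gcongr
      rw [div_le_iff₀ hr]
      nlinarith [norm_nonneg v]
    calc ‖η‖ ^ 2 * ‖h - 1 / (starRingEnd ℂ) η‖
        ≤ ‖η‖ ^ 2 * (‖h‖ ^ 2 / 2
          + ‖(starRingEnd ℂ) v / ((starRingEnd ℂ) z * (starRingEnd ℂ) η)‖) := by
          rw [hsplit]
          gcongr
          exact (norm_sub_le _ _).trans (by gcongr)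
      _ ≤ _ := by nlinarith
  have hexp : ‖h - v‖ ^ 2 - (‖v‖ ^ 2 - 2 * (v / η).re)
      = ‖h‖ ^ 2 - 2 * ((starRingEnd ℂ) v * (h - 1 / (starRingEnd ℂ) η)).re := by
    have e : (v / η).re = ((starRingEnd ℂ) v * (1 / (starRingEnd ℂ) η)).re := by
      rw [← Complex.conj_re (v / η), map_div₀, mul_one_div]
    rw [e, mul_sub, Complex.sub_re, ← Complex.normSq_eq_norm_sq, ← Complex.normSq_eq_norm_sq,
      ← Complex.normSq_eq_norm_sq, Complex.normSq_sub]
    rw [mul_comm h]; ring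
  rw [herr, hexp, le_div_iff₀ (by positivity)]
  have hre : |((starRingEnd ℂ) v * (h - 1 / (starRingEnd ℂ) η)).re|
      ≤ ‖v‖ * ‖h - 1 / (starRingEnd ℂ) η‖ := by
    refine (Complex.abs_re_le_norm _).trans ?_
    rw [norm_mul, RCLike.norm_conj]
  have habs : |‖h‖ ^ 2 - 2 * ((starRingEnd ℂ) v * (h - 1 / (starRingEnd ℂ) η)).re|
      ≤ ‖h‖ ^ 2 + 2 * (‖v‖ * ‖h - 1 / (starRingEnd ℂ) η‖) := by
    rw [abs_le] at hre ⊢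
    constructor <;> nlinarith [sq_nonneg ‖h‖]
  have hv := norm_nonneg v
  calc _ ≤ (‖h‖ ^ 2 + 2 * (‖v‖ * ‖h - 1 / (starRingEnd ℂ) η‖)) * ‖η‖ ^ 2 := by gcongr
    _ = ‖η‖ ^ 2 * ‖h‖ ^ 2 + 2 * ‖v‖ * (‖η‖ ^ 2 * ‖h - 1 / (starRingEnd ℂ) η‖) := by ring
    _ ≤ (2 + ‖v‖) ^ 2 + 2 * ‖v‖ * ((2 + ‖v‖) ^ 2 / 2 + ‖v‖ * (1 + ‖v‖ / 2)) := by gcongr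
    _ ≤ 100 * (1 + ‖v‖ ^ 4) := by
      nlinarith [sq_nonneg (‖v‖ - 1), sq_nonneg (‖v‖ ^ 2 - 1), sq_nonneg (‖v‖ ^ 2 - ‖v‖)]

/-- Below the threshold the noise is at least of the size of the signal, so that any quadratic in
the noise is `O((1 + |v|⁴)/|η|²)`. -/
lemma abs_normSq_sub_one_sub_le {η v : ℂ} (hη : 4 ≤ ‖η‖) (hz : ‖η + v‖ ≤ 2) :
    |‖v‖ ^ 2 - 1 - 2 * (v / η).re| ≤ 100 * (1 + ‖v‖ ^ 4) / ‖η‖ ^ 2 := by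
  have hηv : ‖η‖ ≤ 2 * ‖v‖ := by
    have := norm_sub_le (η + v) v
    rw [add_sub_cancel_right] at this
    linarith
  have hre : |(v / η).re| ≤ ‖v‖ := by
    refine (Complex.abs_re_le_norm _).trans ?_
    rw [norm_div]
    exact div_le_self (norm_nonneg _) (by linarith)
  have hv : 0 ≤ ‖v‖ := norm_nonneg v
  have habs : |‖v‖ ^ 2 - 1 - 2 * (v / η).re| ≤ (1 + ‖v‖) ^ 2 := by
    rw [abs_le] at hre ⊢
    constructor <;> nlinarith
  rw [le_div_iff₀ (by positivity)]
  calc _ ≤ (1 + ‖v‖) ^ 2 * (2 * ‖v‖) ^ 2 := by gcongr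
    _ ≤ 100 * (1 + ‖v‖ ^ 4) := by
      nlinarith [sq_nonneg (‖v‖ - 1), sq_nonneg (‖v‖ ^ 2 - 1), sq_nonneg (‖v‖ ^ 2 - ‖v‖)]

lemma swMap_eq_mul (H : ℂ) (Sv : ℝ) (z : ℂ) :
    swMap H Sv z = (Real.sqrt Sv : ℂ) / H * swMap 1 1 z := by
  unfold swMap
  split_ifs
  · simp [mul_assoc]
  · simp

lemma measurable_swMap (H : ℂ) (Sv : ℝ) : Measurable (swMap H Sv) := by
  unfold swMap
  refine Measurable.ite (measurableSet_lt measurable_const measurable_norm) ?_ measurable_const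
  fun_prop

/-- The excess over `1` of the normalized squared error above the threshold is
`|v|² - 1 - 2 Re (v/η)` up to `O((1 + |v|⁴)/|η|²)`. -/
lemma abs_indicator_sub_le {η v : ℂ} (hη : 4 ≤ ‖η‖) :
    |(if 2 < ‖η + v‖ then ‖η - swMap 1 1 (η + v)‖ ^ 2 - 1 else 0)
        - (‖v‖ ^ 2 - 1 - 2 * (v / η).re)| ≤ 100 * (1 + ‖v‖ ^ 4) / ‖η‖ ^ 2 := by
  split_ifs with hz
  · have h1 : 4 * (‖η + v‖ ^ 2)⁻¹ ≤ 1 := by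
      rw [← div_eq_mul_inv, div_le_one (by positivity)]
      nlinarith
    have := abs_normSq_sub_shrink_le hη hz (Real.sqrt_nonneg _)
      (Real.sq_sqrt (sub_nonneg.2 h1))
    simp only [swMap, if_pos hz]
    convert this using 2
    simp
    ring
  · rw [zero_sub, abs_neg]
    exact abs_normSq_sub_one_sub_le hη (not_lt.1 hz)

lemma memLp_of_map_eq_gaussianReal {Ω : Type*} [MeasurableSpace Ω] {μ : Measure Ω} {W : Ω → ℝ}
    {m : ℝ} {σ2 : NNReal} (hW : Measurable W) (h : μ.map W = gaussianReal m σ2) (p : NNReal) :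
    MemLp W p μ := by
  have : MemLp (id : ℝ → ℝ) p (μ.map W) := h ▸ memLp_id_gaussianReal p
  exact this.comp_of_map hW.aemeasurable

lemma integral_of_map_eq_gaussianReal {Ω : Type*} [MeasurableSpace Ω] {μ : Measure Ω} {W : Ω → ℝ}
    {m : ℝ} {σ2 : NNReal} (hW : Measurable W) (h : μ.map W = gaussianReal m σ2) :
    ∫ ω, W ω ∂μ = m := by
  have := integral_map (f := (id : ℝ → ℝ)) hW.aemeasurable
    (by fun_prop : AEStronglyMeasurable _ (μ.map W))
  rw [h] at this
  simpa using this.symm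

lemma integral_sq_of_map_eq_gaussianReal {Ω : Type*} [MeasurableSpace Ω] {μ : Measure Ω}
    {W : Ω → ℝ} {σ2 : NNReal} (hW : Measurable W) (h : μ.map W = gaussianReal 0 σ2) :
    ∫ ω, W ω ^ 2 ∂μ = σ2 := by
  have e := integral_map (f := fun x : ℝ => x ^ 2) hW.aemeasurable
    (by fun_prop : AEStronglyMeasurable _ (μ.map W))
  rw [← e, h]
  have := variance_id_gaussianReal (μ := 0) (v := σ2)
  rw [variance_eq_integral (by fun_prop)] at this
  simpa using this

/-- Theorem 4, high-SNR MSE: with `η = H·X/√S_v`,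
`p(η) = P(|η + V| > 2)` and `MSE(X) = E[|X - X̂_SW(η + V)|²]` for standard complex
Gaussian noise `V`, there are `C, η₀ > 0` such that for all `X` with `|η| ≥ η₀`,
`|MSE(X) - ((1 - p(η))·|X|² + p(η)·σ_eff²)| ≤ C/|η|²`, where `σ_eff² = S_v/|H|²`. -/
theorem sw_mse_high_snr
    {Ω : Type*} [MeasurableSpace Ω] (μ : Measure Ω) [IsProbabilityMeasure μ]
    (H : ℂ) (hH : H ≠ 0) (Sv : ℝ) (hSv : 0 < Sv)
    (Vr Vi : Ω → ℝ) (hVrm : Measurable Vr) (hVim : Measurable Vi)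
    (hVr : μ.map Vr = gaussianReal 0 (1 / 2)) (hVi : μ.map Vi = gaussianReal 0 (1 / 2))
    (hindep : IndepFun Vr Vi μ)
    (V : Ω → ℂ) (hV : ∀ ω, V ω = (Vr ω : ℂ) + (Vi ω : ℂ) * Complex.I) :
    let σeff2 : ℝ := Sv / ‖H‖ ^ 2
    ∃ C > 0, ∃ η₀ > 0, ∀ X : ℂ,
      let η : ℂ := H * X / (Real.sqrt Sv : ℂ)
      η₀ ≤ ‖η‖ →
      |(∫ ω, ‖X - swMap H Sv (η + V ω)‖ ^ 2 ∂μ)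
          - ((1 - (μ {ω | 2 < ‖η + V ω‖}).toReal) * ‖X‖ ^ 2
              + (μ {ω | 2 < ‖η + V ω‖}).toReal * σeff2)|
        ≤ C / ‖η‖ ^ 2 := by
  intro σeff2
  have hσ : 0 < σeff2 := by have := norm_pos_iff.2 hH; positivity
  have hVm : Measurable V := by rw [funext hV]; fun_prop
  have hVsq : ∀ ω, ‖V ω‖ ^ 2 = Vr ω ^ 2 + Vi ω ^ 2 := fun ω => by
    rw [hV, ← Complex.normSq_eq_norm_sq, Complex.normSq_add_mul_I]
  have hrL : ∀ p : NNReal, MemLp Vr p μ := memLp_of_map_eq_gaussianReal hVrm hVr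
  have hiL : ∀ p : NNReal, MemLp Vi p μ := memLp_of_map_eq_gaussianReal hVim hVi
  have hr1 : Integrable Vr μ := (hrL 1).integrable (by norm_num)
  have hi1 : Integrable Vi μ := (hiL 1).integrable (by norm_num)
  have hr2 : Integrable (fun ω => Vr ω ^ 2) μ := (hrL 2).integrable_sq
  have hi2 : Integrable (fun ω => Vi ω ^ 2) μ := (hiL 2).integrable_sq
  have hV4 : Integrable (fun ω => ‖V ω‖ ^ 4) μ := by
    have hbd : Integrable (fun ω => 2 * (Vr ω ^ 4 + Vi ω ^ 4)) μ := by
      refine Integrable.const_mul (Integrable.add ?_ ?_) 2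
      · simpa [Even.pow_abs (by decide : Even 4)] using (hrL 4).integrable_norm_pow' (p := 4)
      · simpa [Even.pow_abs (by decide : Even 4)] using (hiL 4).integrable_norm_pow' (p := 4)
    refine hbd.mono' (by fun_prop) (.of_forall fun ω => ?_)
    rw [Real.norm_of_nonneg (by positivity), show ‖V ω‖ ^ 4 = (‖V ω‖ ^ 2) ^ 2 by ring, hVsq]
    nlinarith [sq_nonneg (Vr ω ^ 2 - Vi ω ^ 2)]
  set M : ℝ := ∫ ω, 100 * (1 + ‖V ω‖ ^ 4) ∂μ
  have hM0 : 0 ≤ M := integral_nonneg fun ω => by positivity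
  refine ⟨σeff2 * M + 1, by positivity, 4, by norm_num, ?_⟩
  intro X η hη
  set c : ℂ := (Real.sqrt Sv : ℂ) / H with hc
  have hX : X = c * η := by
    have : (Real.sqrt Sv : ℂ) ≠ 0 := by exact_mod_cast (Real.sqrt_pos.2 hSv).ne'
    simp only [hc, η]; field_simp
  have hc2 : ‖c‖ ^ 2 = σeff2 := by
    rw [hc, norm_div, div_pow, Complex.norm_of_nonneg (Real.sqrt_nonneg _), Real.sq_sqrt hSv.le]
  set S : Set Ω := {ω | 2 < ‖η + V ω‖}
  have hSm : MeasurableSet S := measurableSet_lt measurable_const (by fun_prop)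
  set A : Ω → ℝ := fun ω =>
    if 2 < ‖η + V ω‖ then ‖η - swMap 1 1 (η + V ω)‖ ^ 2 - 1 else 0 with hA
  have hAm : Measurable A := by
    have := (measurable_swMap 1 1).comp (hVm.const_add η)
    exact Measurable.ite hSm (((this.const_sub η).norm.pow_const 2).sub_const 1) measurable_const
  set Q : Ω → ℝ := fun ω => ‖V ω‖ ^ 2 - 1 - 2 * (V ω / η).re with hQ
  have hQ' : Q = fun ω => Vr ω ^ 2 + Vi ω ^ 2 - 1
      - (2 * (η⁻¹).re * Vr ω - 2 * (η⁻¹).im * Vi ω) := by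
    funext ω
    simp only [hQ]
    rw [hVsq, hV, div_eq_mul_inv, Complex.mul_re]
    simp
    ring
  have hsq : Integrable (fun ω => Vr ω ^ 2 + Vi ω ^ 2) μ := hr2.add hi2
  have hsq1 : Integrable (fun ω => Vr ω ^ 2 + Vi ω ^ 2 - 1) μ := hsq.sub (integrable_const 1)
  have hlin : Integrable (fun ω => 2 * (η⁻¹).re * Vr ω - 2 * (η⁻¹).im * Vi ω) μ :=
    (hr1.const_mul _).sub (hi1.const_mul _)
  have hQi : Integrable Q μ := by
    rw [hQ']
    exact hsq1.sub hlin
  have hQ0 : ∫ ω, Q ω ∂μ = 0 := by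
    simp only [hQ']
    rw [integral_sub hsq1 hlin, integral_sub hsq (integrable_const 1), integral_add hr2 hi2,
      integral_sub (hr1.const_mul _) (hi1.const_mul _), integral_const_mul, integral_const_mul,
      integral_of_map_eq_gaussianReal hVrm hVr, integral_of_map_eq_gaussianReal hVim hVi,
      integral_sq_of_map_eq_gaussianReal hVrm hVr, integral_sq_of_map_eq_gaussianReal hVim hVi]
    norm_num
  have hbound : ∀ ω, ‖A ω - Q ω‖ ≤ 100 * (1 + ‖V ω‖ ^ 4) / ‖η‖ ^ 2 :=
    fun ω => abs_indicator_sub_le hη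
  have hbi : Integrable (fun ω => 100 * (1 + ‖V ω‖ ^ 4) / ‖η‖ ^ 2) μ :=
    (((integrable_const 1).add hV4).const_mul 100).div_const _
  have hRi : Integrable (fun ω => A ω - Q ω) μ :=
    hbi.mono' (hAm.aestronglyMeasurable.sub hQi.aestronglyMeasurable) (.of_forall hbound)
  have hAi : Integrable A μ :=
    (hRi.add hQi).congr (.of_forall fun ω => sub_add_cancel (A ω) (Q ω))
  have hAint : |∫ ω, A ω ∂μ| ≤ M / ‖η‖ ^ 2 := by
    have h1 := norm_integral_le_of_norm_le hbi (.of_forall hbound)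
    rwa [integral_sub hAi hQi, hQ0, sub_zero, integral_div] at h1
  have hpt : ∀ ω, ‖X - swMap H Sv (η + V ω)‖ ^ 2
      = σeff2 * A ω + (‖X‖ ^ 2 + S.indicator (fun _ => σeff2 - ‖X‖ ^ 2) ω) := by
    intro ω
    by_cases hω : 2 < ‖η + V ω‖
    · rw [Set.indicator_of_mem (show ω ∈ S from hω)]
      simp only [hA, if_pos hω]
      rw [swMap_eq_mul, ← hc]
      nth_rewrite 1 [hX]
      rw [← mul_sub, norm_mul, mul_pow, hc2]
      ring
    · rw [Set.indicator_of_notMem (show ω ∉ S from hω)]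
      simp [hA, hω, swMap]
  have hind : Integrable (S.indicator fun _ => σeff2 - ‖X‖ ^ 2) μ :=
    (integrable_const _).indicator hSm
  have hind' : Integrable (fun ω => ‖X‖ ^ 2 + S.indicator (fun _ => σeff2 - ‖X‖ ^ 2) ω) μ :=
    (integrable_const _).add hind
  have hint : ∫ ω, ‖X - swMap H Sv (η + V ω)‖ ^ 2 ∂μ
      = σeff2 * (∫ ω, A ω ∂μ) + (‖X‖ ^ 2 + (μ S).toReal * (σeff2 - ‖X‖ ^ 2)) := by
    simp_rw [hpt]
    rw [integral_add (hAi.const_mul _) hind', integral_const_mul,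
      integral_add (integrable_const _) hind, integral_indicator_const _ hSm]
    simp [Measure.real]
  rw [hint]
  calc _ = σeff2 * |∫ ω, A ω ∂μ| := by
        rw [← abs_of_pos hσ, ← abs_mul, abs_of_pos hσ]; congr 1; ring
    _ ≤ σeff2 * (M / ‖η‖ ^ 2) := by gcongr
    _ = σeff2 * M / ‖η‖ ^ 2 := by ring
    _ ≤ (σeff2 * M + 1) / ‖η‖ ^ 2 := by gcongr; linarith
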